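/- Let d, s, r ∈ ℕ, let R ⊆ ℤ∖{0}, and let p_1,…,p_r be integral polynomials with zero constant term. Let β_1,…,β_s be irrational and let T = S_1 × ⋯ × S_s on X = 𝕋^{sd}, where S_j is the standard Weyl system of dimension d with rotation β_j; let μ be the Haar probability measure on X. Assume that for every finite list q_1,…,q_m of integral polynomials belonging to WP_d(P) (P = (p_1,…,p_r)) and every ε > 0 there exists n ∈ R such that ‖q_i(n)β_j‖ < ε for all 1 ≤ i ≤ m and 1 ≤ j ≤ s. Then for every Borel set A ⊆ X with μ(A) > 0 there exists n ∈ R such that μ(A ∩ T^{−p_1(n)}A ∩ ⋯ ∩ T^{−p_r(n)}A) > 0. -/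

import Mathlib

open MeasureTheory Polynomial Filter

noncomputable section

/-- An integral polynomial: a real polynomial taking integer values on the integers. -/
def IsIntegralPoly (p : Polynomial ℝ) : Prop := ∀ n : ℤ, ∃ m : ℤ, p.eval (n : ℝ) = (m : ℝ)

/-- The integer value of an (integral) polynomial at an integer. -/
def ieval (p : Polynomial ℝ) (n : ℤ) : ℤ := ⌊p.eval (n : ℝ)⌋

/-- A family of polynomials is essentially distinct if each member and each
difference of two distinct members is non-constant. -/
def EssentiallyDistinct {r : ℕ} (P : Fin r → Polynomial ℝ) : Prop :=
  (∀ i, 0 < (P i).natDegree) ∧ ∀ i j, i ≠ j → 0 < (P i - P j).natDegree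

/-- `p^[j]`: the polynomial `x ↦ p(x)(p(x)-1)⋯(p(x)-j+1)/j!`. -/
def pbr (p : Polynomial ℝ) (j : ℕ) : Polynomial ℝ :=
  Polynomial.C (1 / (Nat.factorial j : ℝ)) * ∏ i ∈ Finset.range j, (p - Polynomial.C (i : ℝ))

/-- The matrix `Λ_k(P)(x)`.  Rows are indexed by pairs `(i, m) ∈ Fin k × Fin r`
(zero-based), the pair `(i, m)` corresponding to row `i·r + m + 1` in the one-based
numbering: the entry in row `(i, m)` and column `c` is `p_m^{[i−c+1]}(x)` if `c ≤ i`
and `0` otherwise. -/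
def Lam {r : ℕ} (P : Fin r → Polynomial ℝ) (k : ℕ) (x : ℝ) :
    Matrix (Fin k × Fin r) (Fin k) ℝ := fun ρ c =>
  if (c : ℕ) ≤ (ρ.1 : ℕ) then (pbr (P ρ.2) ((ρ.1 : ℕ) - (c : ℕ) + 1)).eval x else 0

/-- The `k`-Weyl polynomials generated by the family `P` (with `WP P 0 = {0}`
by convention).  `WP P 1` is the real span of the members of `P`; for `k ≥ 2`,
`WP P k` is the set of real polynomials of the form `x ↦ (vᵀ Λ_k(P)(x))₁` where
`v ∈ ℝ^{kr}` is such that its vector `w` of last `(k−1)r` coordinates satisfies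
`wᵀ Λ_{k−1}(P)(x) = 0` for all `x`. -/
def WP {r : ℕ} (P : Fin r → Polynomial ℝ) : ℕ → Set (Polynomial ℝ)
  | 0 => {0}
  | 1 => (Submodule.span ℝ (Set.range P) : Submodule ℝ (Polynomial ℝ))
  | (k + 2) => { q | ∃ v : Fin (k + 2) × Fin r → ℝ,
      (∀ x : ℝ, Matrix.vecMul (fun w : Fin (k + 1) × Fin r => v (w.1.succ, w.2))
          (Lam P (k + 1) x) = 0) ∧
      ∀ x : ℝ, q.eval x = Matrix.vecMul v (Lam P (k + 2) x) 0 }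

end

noncomputable section

abbrev Torus := AddCircle (1 : ℝ)

/-- The standard Weyl system of dimension `d` with rotation `α` on `𝕋^d`. -/
def stdWeyl (d : ℕ) (α : Torus) : (Fin d → Torus) → (Fin d → Torus) := fun x j =>
  if h : (j : ℕ) = 0 then x j + α
  else x j + x ⟨(j : ℕ) - 1, by have := j.isLt; omega⟩

open UnitAddTorus in
theorem mFourier_eq_toCircle {I : Type*} [Fintype I] (v : I → ℤ) (y : UnitAddTorus I) :
    mFourier v y = ((∑ a, v a • y a : UnitAddCircle).toCircle : ℂ) := by
  classical
  have h : ∀ s : Finset I,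
      ((∑ a ∈ s, v a • y a : UnitAddCircle).toCircle : ℂ) = ∏ a ∈ s, fourier (v a) (y a) := by
    intro s
    induction s using Finset.induction_on with
    | empty => simp
    | insert a s ha ih =>
      rw [Finset.sum_insert ha, Finset.prod_insert ha, AddCircle.toCircle_add, Circle.coe_mul, ih,
        fourier_apply]
  exact (h Finset.univ).symm

theorem integral_toCircle_eq_zero {G : Type*} [AddGroup G] [MeasurableSpace G] [MeasurableAdd G]
    (μ : Measure G) [μ.IsAddRightInvariant] (Φ : G → Torus) (y : G) (c : Torus) (hc : c ≠ 0)
    (h : ∀ x, Φ (x + y) = Φ x + c) : ∫ x, ((Φ x).toCircle : ℂ) ∂μ = 0 := by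
  have h1 : ∫ x, ((Φ x).toCircle : ℂ) ∂μ = (∫ x, ((Φ x).toCircle : ℂ) ∂μ) * (c.toCircle : ℂ) := by
    conv_lhs => rw [← integral_add_right_eq_self _ y]
    simp_rw [h, AddCircle.toCircle_add, Circle.coe_mul]
    exact integral_mul_const _ _
  have h2 : (c.toCircle : ℂ) ≠ 1 := by
    intro h3
    apply hc
    apply AddCircle.injective_toCircle (one_ne_zero (α := ℝ))
    apply Subtype.ext
    simpa using h3
  by_contra h4
  apply h2
  have := mul_left_cancel₀ h4 (h1.symm.trans (mul_one _).symm)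
  exact this

theorem exists_zsmul_ne_zero (b : ℤ) (hb : b ≠ 0) : ∃ τ : Torus, b • τ ≠ 0 := by
  refine ⟨((1 / (2 * b) : ℝ) : Torus), fun h => ?_⟩
  rw [← AddCircle.coe_zsmul, AddCircle.coe_eq_zero_iff] at h
  obtain ⟨n, hn⟩ := h
  have hb' : (b : ℝ) ≠ 0 := by exact_mod_cast hb
  have : (2 * n : ℝ) = 1 := by
    simp only [zsmul_eq_mul, mul_one] at hn
    rw [hn]; field_simp
  have h2 : (2 * n : ℤ) = 1 := by exact_mod_cast this
  omega

open UnitAddTorus in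
/-- Weyl's criterion: convergence of the Fourier coefficients implies weak convergence. -/
theorem tendsto_of_tendsto_mFourier {I : Type*} [Fintype I] {γ : Type*} (L : Filter γ)
    (ν : γ → ProbabilityMeasure (UnitAddTorus I)) (ν' : ProbabilityMeasure (UnitAddTorus I))
    (h : ∀ v : I → ℤ, Tendsto (fun n => ∫ y, mFourier v y ∂(ν n : Measure (UnitAddTorus I))) L
      (nhds (∫ y, mFourier v y ∂(ν' : Measure (UnitAddTorus I))))) :
    Tendsto ν L (nhds ν') := by
  rw [ProbabilityMeasure.tendsto_iff_forall_integral_rclike_tendsto ℂ]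
  intro f
  have hint : ∀ (g : C(UnitAddTorus I, ℂ)) (ρ : ProbabilityMeasure (UnitAddTorus I)),
      Integrable g (ρ : Measure (UnitAddTorus I)) := fun g ρ =>
    (BoundedContinuousFunction.mkOfCompact g).integrable _
  have hspan : ∀ g ∈ Submodule.span ℂ (Set.range (mFourier (d := I))),
      Tendsto (fun n => ∫ y, g y ∂(ν n : Measure (UnitAddTorus I))) L
      (nhds (∫ y, g y ∂(ν' : Measure (UnitAddTorus I)))) := by
    intro g hg
    induction hg using Submodule.span_induction with
    | mem g hg => obtain ⟨v, rfl⟩ := hg; exact h v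
    | zero => simpa using tendsto_const_nhds
    | add g₁ g₂ _ _ h₁ h₂ =>
      simp only [ContinuousMap.add_apply]
      simp_rw [integral_add (hint g₁ _) (hint g₂ _)]
      exact h₁.add h₂
    | smul c g _ h₁ =>
      simp only [ContinuousMap.smul_apply, integral_smul]
      exact h₁.const_smul c
  have hdist : ∀ (g₁ g₂ : C(UnitAddTorus I, ℂ)) (ρ : ProbabilityMeasure (UnitAddTorus I)),
      dist (∫ y, g₁ y ∂(ρ : Measure (UnitAddTorus I)))
        (∫ y, g₂ y ∂(ρ : Measure (UnitAddTorus I))) ≤ dist g₁ g₂ := by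
    intro g₁ g₂ ρ
    rw [dist_eq_norm, ← integral_sub (hint g₁ _) (hint g₂ _), dist_eq_norm]
    refine (norm_integral_le_of_norm_le_const (C := ‖g₁ - g₂‖)
      (Eventually.of_forall fun y => ?_)).trans ?_
    · exact (g₁ - g₂).norm_coe_le_norm y
    · simp
  rw [Metric.tendsto_nhds]
  intro ε hε
  have hf : f.toContinuousMap ∈
      closure (Submodule.span ℂ (Set.range (mFourier (d := I))) : Set C(UnitAddTorus I, ℂ)) := by
    have := span_mFourier_closure_eq_top (d := I)
    rw [← Submodule.topologicalClosure_coe, this]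
    trivial
  obtain ⟨g, hg, hfg⟩ := Metric.mem_closure_iff.1 hf (ε / 3) (by positivity)
  filter_upwards [Metric.tendsto_nhds.1 (hspan g hg) (ε / 3) (by positivity)] with n hn
  have h1 := hdist f.toContinuousMap g (ν n)
  have h2 := hdist f.toContinuousMap g ν'
  have h3 := dist_triangle4 (∫ y, f y ∂(ν n : Measure (UnitAddTorus I)))
    (∫ y, g y ∂(ν n : Measure (UnitAddTorus I))) (∫ y, g y ∂(ν' : Measure (UnitAddTorus I)))
    (∫ y, f y ∂(ν' : Measure (UnitAddTorus I)))
  rw [dist_comm (∫ y, g y ∂(ν' : Measure (UnitAddTorus I)))] at h3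
  change dist (∫ y, f y ∂(ν n : Measure (UnitAddTorus I))) _ ≤ _ at h1
  change dist (∫ y, f y ∂(ν' : Measure (UnitAddTorus I))) _ ≤ _ at h2
  linarith

/-- If measures on a space converge weakly, the coordinates `π m` being distributed
by `μ` along the way, then a measurable box charged by the limit is eventually charged. -/
theorem eventually_measure_iInter_preimage_pos {Y X ι γ : Type*} [Fintype ι]
    [TopologicalSpace Y] [MeasurableSpace Y] [OpensMeasurableSpace Y] [HasOuterApproxClosed Y]
    [TopologicalSpace X] [MeasurableSpace X] [OpensMeasurableSpace X]
    (μ : Measure X) [IsFiniteMeasure μ] [μ.OuterRegular]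
    (π : ι → Y → X) (hπ : ∀ m, Continuous (π m))
    (L : Filter γ) (ν : γ → ProbabilityMeasure Y) (ν' : ProbabilityMeasure Y)
    (hν : Tendsto ν L (nhds ν'))
    (hmp : ∀ n m (B : Set X), MeasurableSet B → (ν n : Measure Y) (π m ⁻¹' B) = μ B)
    (A : Set X) (hA : MeasurableSet A) (hpos : 0 < (ν' : Measure Y) (⋂ m, π m ⁻¹' A)) :
    ∀ᶠ n in L, 0 < (ν n : Measure Y) (⋂ m, π m ⁻¹' A) := by
  set c := (ν' : Measure Y) (⋂ m, π m ⁻¹' A) with hc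
  have hctop : c ≠ ⊤ := measure_ne_top _ _
  obtain ⟨δ, hδ0, hδ⟩ : ∃ δ : ENNReal, 0 < δ ∧ Fintype.card ι * δ < c := by
    refine ⟨c / (Fintype.card ι + 1), ENNReal.div_pos hpos.ne' (by finiteness), ?_⟩
    rw [← mul_div_assoc]
    apply ENNReal.div_lt_of_lt_mul
    rw [mul_comm]
    exact ENNReal.mul_lt_mul_right hpos.ne' hctop (ENNReal.lt_add_right (by simp) (by simp))
  obtain ⟨U, hAU, hU, -, hUA⟩ := hA.exists_isOpen_sdiff_lt (μ := μ) (measure_ne_top _ _) hδ0.ne'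
  have hopen : IsOpen (⋂ m, π m ⁻¹' U) := isOpen_iInter_of_finite fun m => hU.preimage (hπ m)
  have hlim := ProbabilityMeasure.le_liminf_measure_open_of_tendsto hν hopen
  have hlt : Fintype.card ι * δ < liminf (fun n => (ν n : Measure Y) (⋂ m, π m ⁻¹' U)) L :=
    (hδ.trans_le (measure_mono (Set.iInter_mono fun m => Set.preimage_mono hAU))).trans_le hlim
  filter_upwards [eventually_lt_of_lt_liminf hlt] with n hn
  rw [pos_iff_ne_zero]
  intro h0
  apply hn.not_ge
  calc (ν n : Measure Y) (⋂ m, π m ⁻¹' U)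
      ≤ (ν n : Measure Y) ((⋂ m, π m ⁻¹' A) ∪ ⋃ m, π m ⁻¹' (U \ A)) := by
        apply measure_mono
        intro y hy
        by_cases h : ∀ m, π m y ∈ A
        · exact Or.inl (Set.mem_iInter.2 h)
        · push Not at h
          obtain ⟨m, hm⟩ := h
          exact Or.inr (Set.mem_iUnion.2 ⟨m, Set.mem_iInter.1 hy m, hm⟩)
    _ ≤ 0 + ∑ m : ι, (ν n : Measure Y) (π m ⁻¹' (U \ A)) := by
        refine (measure_union_le _ _).trans ?_
        rw [h0]
        gcongr
        exact measure_iUnion_fintype_le _ _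
    _ ≤ 0 + ∑ m : ι, δ := by
        gcongr with m
        rw [hmp n m _ (hU.measurableSet.diff hA)]
        exact hUA.le
    _ = Fintype.card ι * δ := by simp

/-- Translates of a set of positive Haar measure by simultaneously small amounts intersect it. -/
theorem eventually_measure_iInter_add_pos {X Z ι : Type*} [Fintype ι] [AddCommGroup X]
    [TopologicalSpace X] [IsTopologicalAddGroup X] [CompactSpace X] [T2Space X]
    [MeasurableSpace X] [BorelSpace X] (μ : Measure X) [IsFiniteMeasure μ] [μ.Regular]
    [μ.IsAddLeftInvariant] [TopologicalSpace Z] (θ : ι → Z → X) (hθ : ∀ m, Continuous (θ m))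
    (z₀ : Z) (h0 : ∀ m, θ m z₀ = 0) (A : Set X) (hA : MeasurableSet A) (hpos : 0 < μ A) :
    ∀ᶠ z in nhds z₀, 0 < μ {x | ∀ m, x + θ m z ∈ A} := by
  have key : ∀ m, Tendsto (fun z => μ (A \ {x | x + θ m z ∈ A})) (nhds z₀) (nhds 0) := by
    intro m
    let f : Z → C(X, X) := fun z => ⟨fun x => x + θ m z, by fun_prop⟩
    have hf : Continuous f :=
      ContinuousMap.continuous_of_continuous_uncurry _ (by
        have := hθ m
        change Continuous fun p : Z × X => p.2 + θ m p.1
        fun_prop)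
    have hmp : ∀ z, MeasurePreserving (f z) μ μ := fun z => measurePreserving_add_right μ (θ m z)
    have := tendsto_measure_symmDiff_preimage_nhds_zero (hf.tendsto z₀)
      (Eventually.of_forall hmp) (hmp z₀) hA.nullMeasurableSet (measure_ne_top μ A)
    refine tendsto_of_tendsto_of_tendsto_of_le_of_le tendsto_const_nhds this
      (fun _ => zero_le) (fun z => measure_mono ?_)
    intro x hx
    refine Or.inr ⟨?_, hx.2⟩
    change x + θ m z₀ ∈ A
    rw [h0, add_zero]
    exact hx.1
  have hsum : Tendsto (fun z => ∑ m, μ (A \ {x | x + θ m z ∈ A})) (nhds z₀) (nhds 0) := by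
    have := tendsto_finsetSum Finset.univ fun m (_ : m ∈ Finset.univ) => key m
    simpa using this
  filter_upwards [hsum.eventually_lt_const hpos] with z hz
  rw [pos_iff_ne_zero]
  intro hzero
  apply hz.not_ge
  calc μ A ≤ μ ({x | ∀ m, x + θ m z ∈ A} ∪ ⋃ m, (A \ {x | x + θ m z ∈ A})) := by
        apply measure_mono
        intro x hx
        by_cases h : ∀ m, x + θ m z ∈ A
        · exact Or.inl h
        · push Not at h
          obtain ⟨m, hm⟩ := h
          exact Or.inr (Set.mem_iUnion.2 ⟨m, hx, hm⟩)
    _ ≤ 0 + ∑ m : ι, μ (A \ {x | x + θ m z ∈ A}) := by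
        refine (measure_union_le _ _).trans ?_
        rw [hzero]
        gcongr
        exact measure_iUnion_fintype_le _ _
    _ = _ := zero_add _

/-- The matrix entries of the `k`-th power of the unipotent shift: binomial coefficients. -/
def wcoef (k : ℤ) (i l : ℕ) : ℤ := if l ≤ i then Ring.choose k (i - l) else 0

theorem wcoef_zero (i l : ℕ) : wcoef 0 i l = if i = l then 1 else 0 := by
  unfold wcoef
  rcases lt_trichotomy i l with h | h | h
  · rw [if_neg (by omega), if_neg (by omega)]
  · subst h; simp
  · rw [if_pos (by omega), if_neg (by omega), Ring.choose_zero_pos _ (by omega)]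

theorem wcoef_succ (k : ℤ) (i l : ℕ) :
    wcoef (k + 1) (i + 1) l = wcoef k (i + 1) l + wcoef k i l := by
  unfold wcoef
  rcases lt_trichotomy (i + 1) l with h | h | h
  · rw [if_neg (by omega), if_neg (by omega), if_neg (by omega), add_zero]
  · subst h; simp
  · rw [if_pos (by omega), if_pos (by omega), if_pos (by omega),
      show i + 1 - l = (i - l) + 1 by omega, Ring.choose_succ_succ, add_comm]

theorem wcoef_at_zero (k : ℤ) (l : ℕ) : wcoef k 0 l = if l = 0 then 1 else 0 := by
  unfold wcoef
  by_cases h : l = 0 <;> simp [h]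

/-- The linear part of the `k`-th power of a product of standard Weyl systems. -/
def wlin (s d : ℕ) (k : ℤ) : (Fin s → Fin d → Torus) →+ (Fin s → Fin d → Torus) where
  toFun x j i := ∑ l : Fin d, wcoef k i l • x j l
  map_zero' := by ext; simp
  map_add' x y := by ext; simp [Finset.sum_add_distrib]

theorem wlin_apply {s d : ℕ} (k : ℤ) (x : Fin s → Fin d → Torus) (j : Fin s) (i : Fin d) :
    wlin s d k x j i = ∑ l : Fin d, wcoef k i l • x j l := rfl

theorem wlin_zero {s d : ℕ} (x : Fin s → Fin d → Torus) : wlin s d 0 x = x := by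
  ext j i
  simp [wlin_apply, wcoef_zero, Fin.val_inj]

@[fun_prop]
theorem continuous_wlin (s d : ℕ) (k : ℤ) : Continuous (wlin s d k) := by
  change Continuous fun (x : Fin s → Fin d → Torus) (j : Fin s) (i : Fin d) =>
    ∑ l : Fin d, wcoef k i l • x j l
  fun_prop

/-- The translation part of the `k`-th power of a product of standard Weyl systems. -/
def wtrans {s d : ℕ} (β : Fin s → ℝ) (k : ℤ) : Fin s → Fin d → Torus := fun j i =>
  Ring.choose k ((i : ℕ) + 1) • (β j : Torus)

theorem weyl_zpow_apply {s d : ℕ} (β : Fin s → ℝ) (T : Equiv.Perm (Fin s → Fin d → Torus))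
    (hT : ∀ x (j : Fin s), T x j = stdWeyl d (β j : Torus) (x j)) (k : ℤ)
    (x : Fin s → Fin d → Torus) : (T ^ k) x = wlin s d k x + wtrans β k := by
  have step : ∀ k : ℤ, T (wlin s d k x + wtrans β k) = wlin s d (k + 1) x + wtrans β (k + 1) := by
    intro k
    ext j i
    rw [hT]
    obtain ⟨i, hi⟩ := i
    rcases i with _ | i
    · simp only [stdWeyl, dite_true, Pi.add_apply, wlin_apply, wtrans, wcoef_at_zero,
        Ring.choose_succ_succ]
      simp only [zero_add, Ring.choose_one_right, Ring.choose_zero_right, add_smul, one_smul]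
      abel
    · simp only [stdWeyl, Nat.succ_ne_zero, dite_false, Pi.add_apply, wlin_apply, wtrans,
        wcoef_succ, Ring.choose_succ_succ k (i + 1), add_smul, Finset.sum_add_distrib,
        Nat.add_sub_cancel]
      abel
  induction k using Int.induction_on with
  | zero =>
    ext j i
    simp [wlin_zero, wtrans]
  | succ k ih => 
    rw [add_comm (k : ℤ) 1, zpow_one_add, Equiv.Perm.mul_apply, ih, step, add_comm (k : ℤ) 1]
  | pred k ih =>
    apply T.injective
    rw [step, sub_add_cancel, ← ih, ← Equiv.Perm.mul_apply, ← zpow_one_add, add_sub_cancel]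

instance isProbabilityMeasure_volume_torus : IsProbabilityMeasure (volume : Measure Torus) :=
  ⟨UnitAddCircle.measure_univ⟩

instance isAddHaarMeasure_volume_pi (s d : ℕ) :
    (volume : Measure (Fin s → Fin d → Torus)).IsAddHaarMeasure :=
  Measure.pi.isAddHaarMeasure _

instance borelSpace_pi_torus (d : ℕ) : BorelSpace (Fin d → Torus) :=
  have : BorelSpace Torus := inferInstance
  Pi.borelSpace

instance borelSpace_pi_pi_torus (s d : ℕ) : BorelSpace (Fin s → Fin d → Torus) := Pi.borelSpace

instance measurableAdd_prod_pi_torus (K s d : ℕ) :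
    MeasurableAdd ((Fin K → Fin s → Fin d → Torus) × (Fin s → Fin d → Torus)) :=
  have : BorelSpace (Fin K → Fin s → Fin d → Torus) := Pi.borelSpace
  have : BorelSpace ((Fin K → Fin s → Fin d → Torus) × (Fin s → Fin d → Torus)) :=
    Prod.borelSpace
  inferInstance

instance isAddHaarMeasure_volume_pi_pi (K s d : ℕ) :
    (volume : Measure (Fin K → Fin s → Fin d → Torus)).IsAddHaarMeasure :=
  Measure.pi.isAddHaarMeasure _

instance isAddHaarMeasure_volume_prod (K s d : ℕ) :
    (volume : Measure ((Fin K → Fin s → Fin d → Torus) ×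
      (Fin s → Fin d → Torus))).IsAddHaarMeasure :=
  Measure.prod.instIsAddHaarMeasure _ _

theorem weyl_zpow_measurePreserving {s d : ℕ} (β : Fin s → ℝ)
    (T : Equiv.Perm (Fin s → Fin d → Torus))
    (hT : ∀ x (j : Fin s), T x j = stdWeyl d (β j : Torus) (x j)) (k : ℤ) :
    MeasurePreserving (T ^ k : Equiv.Perm _) volume volume := by
  have h1 : MeasurePreserving (wlin s d k) volume volume := by
    refine AddMonoidHom.measurePreserving (continuous_wlin s d k) (fun y => ?_) rfl
    refine ⟨(T ^ k).symm (y + wtrans β k), ?_⟩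
    have := weyl_zpow_apply β T hT k ((T ^ k).symm (y + wtrans β k))
    rw [Equiv.apply_symm_apply] at this
    exact (add_right_cancel this).symm
  have h2 := (measurePreserving_add_right volume (wtrans (d := d) β k)).comp h1
  convert h2 using 1
  ext1 x
  exact weyl_zpow_apply β T hT k x

theorem weyl_zpow_continuous {s d : ℕ} (β : Fin s → ℝ)
    (T : Equiv.Perm (Fin s → Fin d → Torus))
    (hT : ∀ x (j : Fin s), T x j = stdWeyl d (β j : Torus) (x j)) (k : ℤ) :
    Continuous (T ^ k : Equiv.Perm _) := by
  have : ⇑(T ^ k : Equiv.Perm _) = fun x => wlin s d k x + wtrans β k :=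
    funext (weyl_zpow_apply β T hT k)
  rw [this]
  fun_prop

theorem IsIntegralPoly.eval_eq_ieval {p : Polynomial ℝ} (hp : IsIntegralPoly p) (n : ℤ) :
    p.eval (n : ℝ) = (ieval p n : ℝ) := by
  obtain ⟨m, hm⟩ := hp n
  rw [ieval, hm, Int.floor_intCast]

theorem eval_pbr (p : Polynomial ℝ) (j : ℕ) (x : ℝ) (k : ℤ) (h : p.eval x = (k : ℝ)) :
    (pbr p j).eval x = ((Ring.choose k j : ℤ) : ℝ) := by
  have h2 : ((∏ i ∈ Finset.range j, (k - i) : ℤ)) = j.factorial • Ring.choose k j := by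
    rw [← Ring.descPochhammer_eq_factorial_smul_choose, ← descPochhammer_eval_eq_prod_range,
      Polynomial.eval_eq_smeval]
  have h3 : (∏ i ∈ Finset.range j, ((k : ℝ) - i)) = j.factorial * ((Ring.choose k j : ℤ) : ℝ) := by
    have := congrArg (Int.cast : ℤ → ℝ) h2
    push_cast at this
    simpa using this
  have h4 : (j.factorial : ℝ) ≠ 0 := by positivity
  simp only [pbr, eval_mul, eval_C, eval_prod, eval_sub, h, h3]
  field_simp

theorem pbr_zero (p : Polynomial ℝ) : pbr p 0 = 1 := by simp [pbr]

theorem pbr_one (p : Polynomial ℝ) : pbr p 1 = p := by simp [pbr]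

theorem zero_pbr_succ (j : ℕ) : pbr 0 (j + 1) = 0 := by
  simp [pbr, Finset.prod_range_succ']

theorem eval_zero_pbr_succ (p : Polynomial ℝ) (hp : p.eval 0 = 0) (j : ℕ) :
    (pbr p (j + 1)).eval 0 = 0 := by
  simp [pbr, Finset.prod_range_succ', hp, eval_mul]

/-- The character of index `v` evaluated along the linear parts `wlin s d (κ m)`. -/
def phase {ι : Type*} [Fintype ι] {s d : ℕ} (v : ι × Fin s × Fin d → ℤ) (κ : ι → ℤ) :
    (Fin s → Fin d → Torus) →+ Torus where
  toFun y := ∑ a, v a • wlin s d (κ a.1) y a.2.1 a.2.2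
  map_zero' := by simp
  map_add' x y := by simp [Finset.sum_add_distrib]

/-- The coefficients of `phase v κ`. -/
def phaseCoeff {ι : Type*} [Fintype ι] {s d : ℕ} (v : ι × Fin s × Fin d → ℤ) (κ : ι → ℤ)
    (j : Fin s) (l : Fin d) : ℤ :=
  ∑ m, ∑ i : Fin d, v (m, j, i) * wcoef (κ m) i l

theorem phase_eq_sum {ι : Type*} [Fintype ι] {s d : ℕ} (v : ι × Fin s × Fin d → ℤ) (κ : ι → ℤ)
    (y : Fin s → Fin d → Torus) :
    phase v κ y = ∑ j, ∑ l, phaseCoeff v κ j l • y j l := by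
  change ∑ a, v a • wlin s d (κ a.1) y a.2.1 a.2.2 = _
  simp only [wlin_apply, phaseCoeff, Finset.sum_smul, Fintype.sum_prod_type, Finset.smul_sum,
    smul_smul]
  rw [Finset.sum_comm]
  refine Finset.sum_congr rfl fun j _ => ?_
  rw [Finset.sum_comm (s := (Finset.univ : Finset (Fin d)))]
  exact Finset.sum_congr rfl fun m _ => Finset.sum_comm

theorem phase_single {ι : Type*} [Fintype ι] {s d : ℕ} (v : ι × Fin s × Fin d → ℤ) (κ : ι → ℤ)
    (j : Fin s) (l : Fin d) (τ : Torus) :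
    phase v κ (Pi.single j (Pi.single l τ)) = phaseCoeff v κ j l • τ := by
  rw [phase_eq_sum, Finset.sum_eq_single j, Finset.sum_eq_single l]
  · simp
  · intro b _ hb; simp [hb]
  · simp
  · intro b _ hb; simp [hb]
  · simp

/-- The polynomial interpolating `phaseCoeff v` along the values of a family `p`. -/
def phasePoly {ι : Type*} [Fintype ι] {s d : ℕ} (p : ι → Polynomial ℝ)
    (v : ι × Fin s × Fin d → ℤ) (j : Fin s) (l : Fin d) : Polynomial ℝ :=
  ∑ m, ∑ i : Fin d, C (v (m, j, i) : ℝ) * if (l : ℕ) ≤ i then pbr (p m) ((i : ℕ) - l) else 0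

/-- The polynomial describing the constant part of the phase. -/
def transPoly {ι : Type*} [Fintype ι] {s d : ℕ} (p : ι → Polynomial ℝ)
    (v : ι × Fin s × Fin d → ℤ) (j : Fin s) : Polynomial ℝ :=
  ∑ m, ∑ i : Fin d, C (v (m, j, i) : ℝ) * pbr (p m) ((i : ℕ) + 1)

theorem eval_phasePoly {ι : Type*} [Fintype ι] {s d : ℕ} {p : ι → Polynomial ℝ}
    (hp : ∀ m, IsIntegralPoly (p m)) (v : ι × Fin s × Fin d → ℤ) (j : Fin s) (l : Fin d) (n : ℤ) :
    (phasePoly p v j l).eval (n : ℝ) = (phaseCoeff v (fun m => ieval (p m) n) j l : ℤ) := by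
  simp only [phasePoly, phaseCoeff, eval_finsetSum, eval_mul, eval_C, Int.cast_sum, Int.cast_mul]
  refine Finset.sum_congr rfl fun m _ => Finset.sum_congr rfl fun i _ => ?_
  congr 1
  unfold wcoef
  split_ifs
  · exact eval_pbr _ _ _ _ ((hp m).eval_eq_ieval n)
  · simp

theorem eval_transPoly {ι : Type*} [Fintype ι] {s d : ℕ} {p : ι → Polynomial ℝ}
    (hp : ∀ m, IsIntegralPoly (p m)) (v : ι × Fin s × Fin d → ℤ) (j : Fin s) (n : ℤ) :
    (transPoly p v j).eval (n : ℝ) =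
      ((∑ m, ∑ i : Fin d, v (m, j, i) * Ring.choose (ieval (p m) n) ((i : ℕ) + 1) : ℤ) : ℝ) := by
  simp only [transPoly, eval_finsetSum, eval_mul, eval_C, Int.cast_sum, Int.cast_mul]
  refine Finset.sum_congr rfl fun m _ => Finset.sum_congr rfl fun i _ => ?_
  congr 1
  exact eval_pbr _ _ _ _ ((hp m).eval_eq_ieval n)

/-- A bound for the degrees of all the polynomials `phasePoly p v j l`. -/
def degBound {ι : Type*} [Fintype ι] (d : ℕ) (p : ι → Polynomial ℝ) : ℕ :=
  1 + ∑ m, ∑ i ∈ Finset.range d, (pbr (p m) i).natDegree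

theorem natDegree_phasePoly_lt {ι : Type*} [Fintype ι] {s d : ℕ} (p : ι → Polynomial ℝ)
    (v : ι × Fin s × Fin d → ℤ) (j : Fin s) (l : Fin d) :
    (phasePoly p v j l).natDegree < degBound d p := by
  rw [degBound, Nat.lt_one_add_iff]
  refine natDegree_sum_le_of_forall_le _ _ fun m _ =>
    natDegree_sum_le_of_forall_le _ _ fun i _ => ?_
  refine (natDegree_C_mul_le _ _).trans ?_
  split_ifs
  · have h1 := Finset.single_le_sum (f := fun i => (pbr (p m) i).natDegree)
      (fun _ _ => Nat.zero_le _) (Finset.mem_range.2 (show (i : ℕ) - l < d by omega))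
    have h2 := Finset.single_le_sum
      (f := fun m => ∑ i ∈ Finset.range d, (pbr (p m) i).natDegree)
      (fun _ _ => Nat.zero_le _) (Finset.mem_univ m)
    exact h1.trans h2
  · simp

/-- The tuple of points of the orbit of `x` at the times `p m (n)`, in coordinates. -/
def jointOrbit {ι : Type*} {s d : ℕ} (p : ι → Polynomial ℝ)
    (T : Equiv.Perm (Fin s → Fin d → Torus)) (n : ℤ) (x : Fin s → Fin d → Torus) :
    UnitAddTorus (ι × Fin s × Fin d) := fun a => (T ^ ieval (p a.1) n) x a.2.1 a.2.2

/-- The limiting displacement of the coordinate `m`. -/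
def limitShift {ι : Type*} {s d : ℕ} (p : ι → Polynomial ℝ) (K : ℕ) (m : ι)
    (t : Fin K → Fin s → Fin d → Torus) : Fin s → Fin d → Torus :=
  ∑ k : Fin K, (wlin s d (ieval (p m) (k : ℕ)) (t k) - t k)

/-- A parametrization of the limit distribution of `jointOrbit p T n`. -/
def jointLimit {ι : Type*} {s d : ℕ} (p : ι → Polynomial ℝ) (K : ℕ)
    (z : (Fin K → Fin s → Fin d → Torus) × (Fin s → Fin d → Torus)) :
    UnitAddTorus (ι × Fin s × Fin d) := fun a => (z.2 + limitShift p K a.1 z.1) a.2.1 a.2.2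

theorem phase_jointOrbit {ι : Type*} [Fintype ι] {s d : ℕ} {p : ι → Polynomial ℝ}
    (hp : ∀ m, IsIntegralPoly (p m)) (β : Fin s → ℝ) (T : Equiv.Perm (Fin s → Fin d → Torus))
    (hT : ∀ x (j : Fin s), T x j = stdWeyl d (β j : Torus) (x j))
    (v : ι × Fin s × Fin d → ℤ) (n : ℤ) (x : Fin s → Fin d → Torus) :
    ∑ a, v a • jointOrbit p T n x a = phase v (fun m => ieval (p m) n) x +
      ∑ j, (((transPoly p v j).eval (n : ℝ) * β j : ℝ) : Torus) := by
  simp only [jointOrbit, weyl_zpow_apply β T hT, Pi.add_apply, smul_add, Finset.sum_add_distrib]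
  congr 1
  have hcast : ∀ (z : ℤ) (b : ℝ), (((z : ℝ) * b : ℝ) : Torus) = z • (b : Torus) := by
    intro z b
    rw [← zsmul_eq_mul, AddCircle.coe_zsmul]
  simp only [wtrans, eval_transPoly hp, Fintype.sum_prod_type, smul_smul, hcast, Finset.sum_smul]
  rw [Finset.sum_comm]

theorem phase_jointLimit {ι : Type*} [Fintype ι] {s d : ℕ} (p : ι → Polynomial ℝ) (K : ℕ)
    (v : ι × Fin s × Fin d → ℤ)
    (z : (Fin K → Fin s → Fin d → Torus) × (Fin s → Fin d → Torus)) :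
    ∑ a, v a • jointLimit p K z a = phase v 0 z.2 +
      ∑ k : Fin K, (phase v (fun m => ieval (p m) (k : ℕ)) (z.1 k) - phase v 0 (z.1 k)) := by
  simp only [jointLimit, limitShift, phase, AddMonoidHom.coe_mk, ZeroHom.coe_mk, Pi.zero_apply,
    wlin_zero, Pi.add_apply, smul_add, Finset.sum_add_distrib, Finset.sum_apply, Finset.smul_sum,
    Pi.sub_apply, smul_sub, Finset.sum_sub_distrib]
  congr 2 <;> exact Finset.sum_comm

theorem ieval_zero_of_eval_zero {p : Polynomial ℝ} (hp : p.eval 0 = 0) : ieval p 0 = 0 := by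
  simp [ieval, hp]

theorem integral_jointLimit_eq_one {ι : Type*} [Fintype ι] {s d : ℕ} {p : ι → Polynomial ℝ}
    (hp : ∀ m, IsIntegralPoly (p m)) (hz : ∀ m, (p m).eval 0 = 0) (K : ℕ)
    (v : ι × Fin s × Fin d → ℤ) (hv : ∀ j l, phasePoly p v j l = 0) :
    ∫ z, ((∑ a, v a • jointLimit p K z a : UnitAddCircle).toCircle : ℂ) = 1 := by
  have h : ∀ (n : ℤ) y, phase v (fun m => ieval (p m) n) y = 0 := by
    intro n y
    rw [phase_eq_sum]
    refine Finset.sum_eq_zero fun j _ => Finset.sum_eq_zero fun l _ => ?_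
    have := eval_phasePoly hp v j l n
    rw [hv, eval_zero] at this
    rw [show phaseCoeff v (fun m => ieval (p m) n) j l = 0 by exact_mod_cast this.symm, zero_smul]
  have h0 : ∀ y, phase v 0 y = 0 := by
    intro y
    have := h 0 y
    simp only [ieval_zero_of_eval_zero (hz _)] at this
    exact this
  simp [phase_jointLimit, h, h0]

theorem integral_jointLimit_eq_zero {ι : Type*} [Fintype ι] {s d : ℕ} {p : ι → Polynomial ℝ}
    (hp : ∀ m, IsIntegralPoly (p m)) (K : ℕ) (hK : degBound d p ≤ K)
    (v : ι × Fin s × Fin d → ℤ) (j : Fin s) (l : Fin d) (hv : phasePoly p v j l ≠ 0) :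
    ∫ z, ((∑ a, v a • jointLimit p K z a : UnitAddCircle).toCircle : ℂ) = 0 := by
  by_cases h0 : phaseCoeff v 0 j l = 0
  · obtain ⟨k, hk⟩ : ∃ k : Fin K, phaseCoeff v (fun m => ieval (p m) (k : ℕ)) j l ≠ 0 := by
      by_contra! hcon
      apply hv
      refine eq_zero_of_natDegree_lt_card_of_eval_eq_zero _ (f := fun k : Fin K => ((k : ℕ) : ℝ))
        (fun a b hab => Fin.ext (Nat.cast_injective (R := ℝ) hab)) (fun k => ?_) ?_
      · have := eval_phasePoly hp v j l (k : ℕ)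
        rw [hcon k] at this
        simpa using this
      · rw [Fintype.card_fin]
        exact (natDegree_phasePoly_lt p v j l).trans_le hK
    obtain ⟨τ, hτ⟩ := exists_zsmul_ne_zero _ hk
    refine integral_toCircle_eq_zero _ _ (Pi.single k (Pi.single j (Pi.single l τ)), 0) _ hτ ?_
    intro z
    simp only [phase_jointLimit, Prod.snd_add, Prod.fst_add, add_zero, Pi.add_apply, map_add,
      add_sub_add_comm, Finset.sum_add_distrib, add_assoc]
    congr 2
    rw [Finset.sum_eq_single k]
    · simp [phase_single, h0]
    · intro b _ hb; simp [hb]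
    · simp
  · obtain ⟨τ, hτ⟩ := exists_zsmul_ne_zero _ h0
    refine integral_toCircle_eq_zero _ _ (0, Pi.single j (Pi.single l τ)) _ hτ ?_
    intro z
    simp only [phase_jointLimit, Prod.snd_add, Prod.fst_add, add_zero, map_add, phase_single]
    abel

theorem tendsto_integral_jointOrbit {ι : Type*} [Fintype ι] {s d : ℕ} {p : ι → Polynomial ℝ}
    (hp : ∀ m, IsIntegralPoly (p m)) (hz : ∀ m, (p m).eval 0 = 0) (K : ℕ) (hK : degBound d p ≤ K)
    (β : Fin s → ℝ) (T : Equiv.Perm (Fin s → Fin d → Torus))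
    (hT : ∀ x (j : Fin s), T x j = stdWeyl d (β j : Torus) (x j))
    (L : Filter ℤ) (hL : L ≤ cofinite) (v : ι × Fin s × Fin d → ℤ)
    (hv : (∀ j l, phasePoly p v j l = 0) → ∀ j,
      Tendsto (fun n : ℤ => (((transPoly p v j).eval (n : ℝ) * β j : ℝ) : Torus)) L (nhds 0)) :
    Tendsto
      (fun n => ∫ x, ((∑ a, v a • jointOrbit p T n x a : UnitAddCircle).toCircle : ℂ)) L
      (nhds (∫ z, ((∑ a, v a • jointLimit p K z a : UnitAddCircle).toCircle : ℂ))) := by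
  by_cases h : ∀ j l, phasePoly p v j l = 0
  · rw [integral_jointLimit_eq_one hp hz K v h]
    have hphase : ∀ (n : ℤ) y, phase v (fun m => ieval (p m) n) y = 0 := by
      intro n y
      rw [phase_eq_sum]
      refine Finset.sum_eq_zero fun j _ => Finset.sum_eq_zero fun l _ => ?_
      have := eval_phasePoly hp v j l n
      rw [h, eval_zero] at this
      rw [show phaseCoeff v (fun m => ieval (p m) n) j l = 0 by exact_mod_cast this.symm,
        zero_smul]
    simp only [phase_jointOrbit hp β T hT, hphase, zero_add, integral_const, probReal_univ,
      one_smul]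
    have hsum := tendsto_finsetSum Finset.univ fun j (_ : j ∈ Finset.univ) => hv h j
    rw [Finset.sum_const_zero] at hsum
    have hc : Continuous fun c : Torus => (c.toCircle : ℂ) :=
      continuous_subtype_val.comp AddCircle.continuous_toCircle
    have := (hc.tendsto 0).comp hsum
    simp only [AddCircle.toCircle_zero, Circle.coe_one] at this
    exact this
  · push Not at h
    obtain ⟨j, l, hjl⟩ := h
    rw [integral_jointLimit_eq_zero hp K hK v j l hjl]
    refine tendsto_const_nhds.congr' ?_
    have hfin : {n : ℤ | (phasePoly p v j l).eval (n : ℝ) = 0}.Finite :=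
      ((phasePoly p v j l).finite_setOfPred_isRoot hjl).preimage Int.cast_injective.injOn
    filter_upwards [hL hfin.compl_mem_cofinite] with n hn
    have hn' : phaseCoeff v (fun m => ieval (p m) n) j l ≠ 0 := by
      intro h0
      apply hn
      rw [Set.mem_ofPred_eq, eval_phasePoly hp, h0, Int.cast_zero]
    obtain ⟨τ, hτ⟩ := exists_zsmul_ne_zero _ hn'
    refine (integral_toCircle_eq_zero _ _ (Pi.single j (Pi.single l τ)) _ hτ ?_).symm
    intro x
    simp only [phase_jointOrbit hp β T hT, map_add, phase_single]
    abel

theorem mem_WP_self {r : ℕ} (P : Fin r → Polynomial ℝ) (d : ℕ) (hd : 1 ≤ d) (k : Fin r) :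
    P k ∈ WP P d := by
  obtain _ | _ | d := d
  · omega
  · exact Submodule.subset_span (Set.mem_range_self k)
  · refine ⟨Pi.single (0, k) 1, fun x => ?_, fun x => ?_⟩
    · have h : (fun w : Fin (d + 1) × Fin r =>
          (Pi.single (0, k) 1 : Fin (d + 2) × Fin r → ℝ) (w.1.succ, w.2)) = 0 := by
        ext w
        simp
      rw [h, Matrix.zero_vecMul]
    · rw [Matrix.single_one_vecMul]
      simp [Lam, pbr_one]

/-- The family `P` together with the zero polynomial. -/
def addZero {r : ℕ} (P : Fin r → Polynomial ℝ) (o : Option (Fin r)) : Polynomial ℝ := o.elim 0 P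

theorem transPoly_addZero {s d r : ℕ} (P : Fin r → Polynomial ℝ)
    (v : Option (Fin r) × Fin s × Fin d → ℤ) (j : Fin s) :
    transPoly (addZero P) v j =
      ∑ m, ∑ i : Fin d, C (v (some m, j, i) : ℝ) * pbr (P m) ((i : ℕ) + 1) := by
  simp [transPoly, Fintype.sum_option, addZero, zero_pbr_succ]

theorem eval_phasePoly_addZero {s d r : ℕ} (P : Fin r → Polynomial ℝ)
    (hz : ∀ k, (P k).eval 0 = 0) (v : Option (Fin r) × Fin s × Fin d → ℤ) (j : Fin s) (l : Fin d)
    (x : ℝ) :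
    (phasePoly (addZero P) v j l).eval x - (phasePoly (addZero P) v j l).eval 0 =
      ∑ m, ∑ i : Fin d, (v (some m, j, i) : ℝ) *
        if (l : ℕ) < i then (pbr (P m) ((i : ℕ) - l)).eval x else 0 := by
  have key : ∀ (p : Polynomial ℝ), p.eval 0 = 0 → ∀ i : Fin d,
      (if (l : ℕ) ≤ i then pbr p ((i : ℕ) - l) else 0).eval x -
        (if (l : ℕ) ≤ i then pbr p ((i : ℕ) - l) else 0).eval 0 =
      if (l : ℕ) < i then (pbr p ((i : ℕ) - l)).eval x else 0 := by
    intro p hp i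
    rcases lt_trichotomy (l : ℕ) i with h | h | h
    · obtain ⟨e, he⟩ : ∃ e, (i : ℕ) - l = e + 1 := ⟨(i : ℕ) - l - 1, by omega⟩
      rw [if_pos h.le, if_pos h, he, eval_zero_pbr_succ p hp, sub_zero]
    · simp [h, pbr_zero]
    · simp [h.not_ge, h.not_gt]
  simp only [phasePoly, eval_finsetSum, eval_mul, eval_C, ← Finset.sum_sub_distrib, ← mul_sub]
  rw [Fintype.sum_option, Finset.sum_eq_zero, zero_add]
  · simp only [addZero, Option.elim_some, key _ (hz _)]
  · intro i _
    simp only [addZero, Option.elim_none]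
    rw [key 0 eval_zero]
    split_ifs with h
    · obtain ⟨e, he⟩ : ∃ e, (i : ℕ) - l = e + 1 := ⟨(i : ℕ) - l - 1, by omega⟩
      simp [he, zero_pbr_succ]
    · simp

theorem transPoly_mem_WP {s d r : ℕ} (hd : 1 ≤ d) (P : Fin r → Polynomial ℝ)
    (hz : ∀ k, (P k).eval 0 = 0)
    (v : Option (Fin r) × Fin s × Fin d → ℤ) (j : Fin s)
    (hv : ∀ l, phasePoly (addZero P) v j l = 0) : transPoly (addZero P) v j ∈ WP P d := by
  rw [transPoly_addZero]
  obtain _ | _ | d := d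
  · omega
  · refine Submodule.sum_mem _ fun m _ => ?_
    simp only [Nat.reduceAdd, Finset.univ_unique, Fin.default_eq_zero, Finset.sum_singleton,
      Fin.val_zero, zero_add, pbr_one, ← smul_eq_C_mul]
    exact Submodule.smul_mem _ _ (Submodule.subset_span (Set.mem_range_self m))
  · refine ⟨fun ρ => v (some ρ.2, j, ρ.1), fun x => ?_, fun x => ?_⟩
    · ext c
      have h := eval_phasePoly_addZero P hz v j c.castSucc x
      rw [hv, eval_zero, eval_zero, sub_zero] at h
      simp only [Fin.sum_univ_succ (n := d + 1), Fin.val_castSucc, Fin.val_zero, not_lt_zero,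
        if_false, mul_zero, zero_add, Fin.val_succ] at h
      rw [Pi.zero_apply, h, Matrix.vecMul, dotProduct, Fintype.sum_prod_type, Finset.sum_comm]
      refine Finset.sum_congr rfl fun m _ => Finset.sum_congr rfl fun i _ => ?_
      congr 1
      simp only [Lam, Nat.lt_succ_iff]
      split_ifs with hci
      · rw [Nat.sub_add_comm hci]
      · rfl
    · rw [Matrix.vecMul, dotProduct, Fintype.sum_prod_type, Finset.sum_comm]
      simp [eval_finsetSum, Lam]

theorem isIntegralPoly_addZero {r : ℕ} {P : Fin r → Polynomial ℝ}
    (hint : ∀ k, IsIntegralPoly (P k)) (o : Option (Fin r)) : IsIntegralPoly (addZero P o) := by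
  cases o with
  | none => exact fun n => ⟨0, by simp [addZero]⟩
  | some k => exact hint k

theorem isIntegralPoly_transPoly {ι : Type*} [Fintype ι] {s d : ℕ} {p : ι → Polynomial ℝ}
    (hp : ∀ m, IsIntegralPoly (p m)) (v : ι × Fin s × Fin d → ℤ) (j : Fin s) :
    IsIntegralPoly (transPoly p v j) := fun n => ⟨_, eval_transPoly hp v j n⟩

/-- The filter on `ℤ` of neighbourhoods of infinity within `R` along which all `q(n) βⱼ`, `q ∈ S`,
tend to `0` modulo `1`. -/
def recurrenceFilter {s : ℕ} (R : Set ℤ) (S : Set (Polynomial ℝ)) (β : Fin s → ℝ) :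
    Filter ℤ where
  sets := {U | ∃ F : Set ℤ, F.Finite ∧ ∃ Q : Set (Polynomial ℝ), Q.Finite ∧ Q ⊆ S ∧
    ∃ ε : ℝ, 0 < ε ∧ ∀ n ∈ R, n ∉ F →
      (∀ q ∈ Q, ∀ j, ‖((q.eval (n : ℝ) * β j : ℝ) : Torus)‖ < ε) → n ∈ U}
  univ_sets := ⟨∅, Set.finite_empty, ∅, Set.finite_empty, Set.empty_subset _, 1, one_pos,
    fun _ _ _ _ => trivial⟩
  sets_of_superset := by
    rintro U V ⟨F, hF, Q, hQ, hQS, ε, hε, h⟩ hUV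
    exact ⟨F, hF, Q, hQ, hQS, ε, hε, fun n h1 h2 h3 => hUV (h n h1 h2 h3)⟩
  inter_sets := by
    rintro U V ⟨F, hF, Q, hQ, hQS, ε, hε, h⟩ ⟨F', hF', Q', hQ', hQS', ε', hε', h'⟩
    refine ⟨F ∪ F', hF.union hF', Q ∪ Q', hQ.union hQ', Set.union_subset hQS hQS', min ε ε',
      lt_min hε hε', fun n h1 h2 h3 => ⟨h n h1 (fun hn => h2 (Or.inl hn)) fun q hq j => ?_,
        h' n h1 (fun hn => h2 (Or.inr hn)) fun q hq j => ?_⟩⟩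
    · exact (h3 q (Or.inl hq) j).trans_le (min_le_left _ _)
    · exact (h3 q (Or.inr hq) j).trans_le (min_le_right _ _)

theorem recurrenceFilter_le_cofinite {s : ℕ} (R : Set ℤ) (S : Set (Polynomial ℝ))
    (β : Fin s → ℝ) : recurrenceFilter R S β ≤ cofinite := by
  intro U hU
  exact ⟨Uᶜ, hU, ∅, Set.finite_empty, Set.empty_subset _, 1, one_pos,
    fun n _ hn _ => not_not.1 hn⟩

theorem mem_recurrenceFilter {s : ℕ} (R : Set ℤ) (S : Set (Polynomial ℝ))
    (β : Fin s → ℝ) : R ∈ recurrenceFilter R S β :=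
  ⟨∅, Set.finite_empty, ∅, Set.finite_empty, Set.empty_subset _, 1, one_pos, fun _ hn _ _ => hn⟩

theorem tendsto_recurrenceFilter {s : ℕ} (R : Set ℤ) (S : Set (Polynomial ℝ))
    (β : Fin s → ℝ) {q : Polynomial ℝ} (hq : q ∈ S) (j : Fin s) :
    Tendsto (fun n : ℤ => ((q.eval (n : ℝ) * β j : ℝ) : Torus)) (recurrenceFilter R S β)
      (nhds 0) := by
  rw [Metric.tendsto_nhds]
  intro ε hε
  refine ⟨∅, Set.finite_empty, {q}, Set.finite_singleton _, by simpa using hq, ε, hε,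
    fun n _ _ h => ?_⟩
  simpa [dist_eq_norm] using h q rfl j

theorem norm_coe_intCast_mul_pos {b : ℝ} (hb : Irrational b) {z : ℤ} (hz : z ≠ 0) :
    0 < ‖(((z : ℝ) * b : ℝ) : Torus)‖ := by
  rw [norm_pos_iff, Ne, AddCircle.coe_eq_zero_iff]
  rintro ⟨n, hn⟩
  have h := hb.intCast_mul hz
  exact h ⟨n, by simpa using hn⟩

theorem recurrenceFilter_neBot {d s r : ℕ} (hd : 1 ≤ d) (hs : 1 ≤ s) (R : Set ℤ)
    (P : Fin r → Polynomial ℝ) (hint : ∀ k, IsIntegralPoly (P k)) (β : Fin s → ℝ)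
    (hβ : ∀ j, Irrational (β j))
    (hKron : ∀ (m : ℕ) (q : Fin m → Polynomial ℝ),
      (∀ i, q i ∈ WP P d ∧ IsIntegralPoly (q i)) →
      ∀ ε : ℝ, 0 < ε → ∃ n ∈ R, ∀ (i : Fin m) (j : Fin s),
        ‖(((q i).eval (n : ℝ) * β j : ℝ) : Torus)‖ < ε)
    (hne : ∀ n ∈ R, ∃ k, ieval (P k) n ≠ 0) :
    (recurrenceFilter R {q | q ∈ WP P d ∧ IsIntegralPoly q} β).NeBot := by
  refine ⟨fun hbot => ?_⟩
  obtain ⟨F, hF, Q, hQ, hQS, ε, hε, h⟩ := empty_mem_iff_bot.2 hbot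
  have hg : ∀ n : ℤ, ∃ g : ℝ, 0 < g ∧ (n ∈ R → ∃ k,
      g ≤ ‖(((P k).eval (n : ℝ) * β ⟨0, hs⟩ : ℝ) : Torus)‖) := by
    intro n
    by_cases hn : n ∈ R
    · obtain ⟨k, hk⟩ := hne n hn
      refine ⟨_, ?_, fun _ => ⟨k, le_rfl⟩⟩
      rw [(hint k).eval_eq_ieval]
      exact norm_coe_intCast_mul_pos (hβ _) hk
    · exact ⟨1, one_pos, fun h => absurd h hn⟩
  choose g hg0 hg using hg
  obtain ⟨δ, hδ, hδ0⟩ : ∃ δ : ℝ, (∀ n ∈ F, δ < g n) ∧ 0 < δ := by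
    have h1 : ∀ᶠ δ in nhdsWithin (0 : ℝ) (Set.Ioi 0), ∀ n ∈ F, δ < g n :=
      (eventually_all_finite hF).2 fun n _ => nhdsWithin_le_nhds (gt_mem_nhds (hg0 n))
    exact (h1.and self_mem_nhdsWithin).exists
  obtain ⟨m, q, hq⟩ := (hQ.union (Set.finite_range P)).fin_param
  obtain ⟨n, hnR, hn⟩ := hKron m q (fun i => by
    have : q i ∈ Q ∪ Set.range P := by rw [← hq.2]; exact Set.mem_range_self i
    rcases this with h | ⟨k, hk⟩
    · exact hQS h
    · rw [← hk]; exact ⟨mem_WP_self P d hd k, hint k⟩) (min ε δ) (lt_min hε hδ0)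
  have hn' : ∀ p ∈ Q ∪ Set.range P, ∀ j, ‖((p.eval (n : ℝ) * β j : ℝ) : Torus)‖ < min ε δ := by
    intro p hp j
    rw [← hq.2] at hp
    obtain ⟨i, rfl⟩ := hp
    exact hn i j
  refine h n hnR (fun hnF => ?_) fun p hp j => (hn' p (Or.inl hp) j).trans_le (min_le_left _ _)
  obtain ⟨k, hk⟩ := hg n hnR
  have := (hn' (P k) (Or.inr ⟨k, rfl⟩) ⟨0, hs⟩).trans_le (min_le_right _ _)
  exact (this.trans (hδ n hnF)).not_ge hk

theorem continuous_limitShift {ι : Type*} {s d : ℕ} (p : ι → Polynomial ℝ) (K : ℕ) (m : ι) :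
    Continuous (limitShift (s := s) (d := d) p K m) := by
  unfold limitShift
  fun_prop

theorem continuous_jointLimit {ι : Type*} {s d : ℕ} (p : ι → Polynomial ℝ) (K : ℕ) :
    Continuous (jointLimit (s := s) (d := d) p K) := by
  refine continuous_pi fun a => ?_
  have h1 := continuous_limitShift (s := s) (d := d) p K a.1
  have h2 : Continuous fun z : (Fin K → Fin s → Fin d → Torus) × (Fin s → Fin d → Torus) =>
      z.2 + limitShift p K a.1 z.1 := by fun_prop
  exact (continuous_apply a.2.2).comp ((continuous_apply a.2.1).comp h2)

theorem continuous_jointOrbit {ι : Type*} {s d : ℕ} (p : ι → Polynomial ℝ) (β : Fin s → ℝ)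
    (T : Equiv.Perm (Fin s → Fin d → Torus))
    (hT : ∀ x (j : Fin s), T x j = stdWeyl d (β j : Torus) (x j)) (n : ℤ) :
    Continuous (jointOrbit p T n) := by
  refine continuous_pi fun a => ?_
  exact (continuous_apply a.2.2).comp
    ((continuous_apply a.2.1).comp (weyl_zpow_continuous β T hT (ieval (p a.1) n)))

theorem limitShift_zero {ι : Type*} {s d : ℕ} (p : ι → Polynomial ℝ) (K : ℕ) (m : ι) :
    limitShift (s := s) (d := d) p K m 0 = 0 := by
  simp [limitShift]

theorem measure_jointLimit_pos {ι : Type*} [Fintype ι] {s d : ℕ} (p : ι → Polynomial ℝ) (K : ℕ)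
    (A : Set (Fin s → Fin d → Torus)) (hA : MeasurableSet A) (hpos : 0 < volume A) :
    0 < volume {z : (Fin K → Fin s → Fin d → Torus) × (Fin s → Fin d → Torus) |
      ∀ m, z.2 + limitShift p K m z.1 ∈ A} := by
  have hmeas : MeasurableSet {z : (Fin K → Fin s → Fin d → Torus) × (Fin s → Fin d → Torus) |
      ∀ m, z.2 + limitShift p K m z.1 ∈ A} := by
    have : BorelSpace (Fin K → Fin s → Fin d → Torus) := Pi.borelSpace
    have : BorelSpace ((Fin K → Fin s → Fin d → Torus) × (Fin s → Fin d → Torus)) :=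
      Prod.borelSpace
    have h1 : ∀ m, MeasurableSet {z : (Fin K → Fin s → Fin d → Torus) × (Fin s → Fin d → Torus) |
        z.2 + limitShift p K m z.1 ∈ A} := by
      intro m
      have h1 := continuous_limitShift (s := s) (d := d) p K m
      have h2 : Continuous fun z : (Fin K → Fin s → Fin d → Torus) × (Fin s → Fin d → Torus) =>
        z.2 + limitShift p K m z.1 := by fun_prop
      exact h2.measurable hA
    have := MeasurableSet.iInter h1
    convert this using 1
    ext z
    simp
  have hev := eventually_measure_iInter_add_pos volume (limitShift (s := s) (d := d) p K)
    (continuous_limitShift p K) 0 (limitShift_zero p K) A hA hpos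
  rw [pos_iff_ne_zero]
  intro h0
  rw [Measure.volume_eq_prod, Measure.measure_prod_null hmeas] at h0
  obtain ⟨U, hU, hUo, h0U⟩ := eventually_nhds_iff.1 hev
  have hUpos : 0 < volume U := hUo.measure_pos _ ⟨0, h0U⟩
  apply hUpos.ne'
  refine measure_mono_null (fun t ht => ?_) h0
  exact (hU t ht).ne'

theorem eval_zero_addZero {r : ℕ} {P : Fin r → Polynomial ℝ} (hz : ∀ k, (P k).eval 0 = 0)
    (o : Option (Fin r)) : (addZero P o).eval 0 = 0 := by
  cases o with
  | none => exact eval_zero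
  | some k => exact hz k

theorem eventually_measure_iInter_zpow_pos {ι : Type*} [Fintype ι] {s d : ℕ}
    {p : ι → Polynomial ℝ} (hp : ∀ m, IsIntegralPoly (p m)) (hz : ∀ m, (p m).eval 0 = 0)
    (β : Fin s → ℝ) (T : Equiv.Perm (Fin s → Fin d → Torus))
    (hT : ∀ x (j : Fin s), T x j = stdWeyl d (β j : Torus) (x j))
    (L : Filter ℤ) (hL : L ≤ cofinite)
    (hv : ∀ v : ι × Fin s × Fin d → ℤ, (∀ j l, phasePoly p v j l = 0) → ∀ j,
      Tendsto (fun n : ℤ => (((transPoly p v j).eval (n : ℝ) * β j : ℝ) : Torus)) L (nhds 0))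
    (A : Set (Fin s → Fin d → Torus)) (hA : MeasurableSet A) (hpos : 0 < volume A) :
    ∀ᶠ n in L, 0 < volume (⋂ m, (T ^ ieval (p m) n) ⁻¹' A) := by
  set K := degBound d p
  have : BorelSpace (Fin K → Fin s → Fin d → Torus) := Pi.borelSpace
  have : BorelSpace ((Fin K → Fin s → Fin d → Torus) × (Fin s → Fin d → Torus)) :=
    Prod.borelSpace
  have hm : ∀ n, Measurable (jointOrbit p T n) := fun n =>
    (continuous_jointOrbit p β T hT n).measurable
  have hm' : Measurable (jointLimit (s := s) (d := d) p K) :=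
    (continuous_jointLimit p K).measurable
  let ν : ℤ → ProbabilityMeasure (UnitAddTorus (ι × Fin s × Fin d)) := fun n =>
    ⟨volume.map (jointOrbit p T n), Measure.isProbabilityMeasure_map (hm n).aemeasurable⟩
  let ν' : ProbabilityMeasure (UnitAddTorus (ι × Fin s × Fin d)) :=
    ⟨volume.map (jointLimit p K), Measure.isProbabilityMeasure_map hm'.aemeasurable⟩
  have hν : Tendsto ν L (nhds ν') := by
    refine tendsto_of_tendsto_mFourier L ν ν' fun v => ?_
    have h1 : ∀ n, ∫ y, UnitAddTorus.mFourier v y ∂(ν n : Measure _) =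
        ∫ x, ((∑ a, v a • jointOrbit p T n x a : UnitAddCircle).toCircle : ℂ) := by
      intro n
      simp only [← mFourier_eq_toCircle]
      exact integral_map (hm n).aemeasurable
        (UnitAddTorus.mFourier v).continuous.aestronglyMeasurable
    have h2 : ∫ y, UnitAddTorus.mFourier v y ∂(ν' : Measure _) =
        ∫ z, ((∑ a, v a • jointLimit (s := s) (d := d) p K z a : UnitAddCircle).toCircle : ℂ) := by
      simp only [← mFourier_eq_toCircle]
      exact integral_map hm'.aemeasurable
        (UnitAddTorus.mFourier v).continuous.aestronglyMeasurable
    simp only [h1, h2]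
    exact tendsto_integral_jointOrbit hp hz K le_rfl β T hT L hL v (hv v)
  let π : ι → UnitAddTorus (ι × Fin s × Fin d) → Fin s → Fin d → Torus := fun m y j i => y (m, j, i)
  have hπ : ∀ m, Continuous (π m) := fun m => by fun_prop
  have hmeas : MeasurableSet (⋂ m, π m ⁻¹' A) :=
    MeasurableSet.iInter fun m => (hπ m).measurable hA
  have hmp : ∀ n m (B : Set (Fin s → Fin d → Torus)), MeasurableSet B →
      (ν n : Measure _) (π m ⁻¹' B) = volume B := by
    intro n m B hB
    refine (Measure.map_apply (hm n) ((hπ m).measurable hB)).trans ?_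
    exact (weyl_zpow_measurePreserving β T hT (ieval (p m) n)).measure_preimage
      hB.nullMeasurableSet
  have hpos' : 0 < (ν' : Measure _) (⋂ m, π m ⁻¹' A) := by
    refine lt_of_lt_of_eq (measure_jointLimit_pos p K A hA hpos) ?_
    refine Eq.trans ?_ (Measure.map_apply hm' hmeas).symm
    congr 1
    ext z
    simp only [Set.mem_preimage, Set.mem_iInter]
    rfl
  filter_upwards [eventually_measure_iInter_preimage_pos volume π hπ L ν ν' hν hmp A hA hpos']
    with n hn
  refine lt_of_lt_of_eq hn ((Measure.map_apply (hm n) hmeas).trans ?_)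
  rw [Set.preimage_iInter]
  rfl

/-- Sufficient condition for measurable polynomial recurrence in products of standard
Weyl systems: recurrence for the Weyl polynomials in the Kronecker factor implies
`P`-measurable recurrence. -/
theorem stmt13 (d s r : ℕ) (hd : 1 ≤ d) (hs : 1 ≤ s) (hr : 1 ≤ r)
    (R : Set ℤ) (hR : 0 ∉ R)
    (P : Fin r → Polynomial ℝ)
    (hint : ∀ k, IsIntegralPoly (P k)) (hz : ∀ k, (P k).eval 0 = 0)
    (β : Fin s → ℝ) (hβ : ∀ j, Irrational (β j))
    (T : Equiv.Perm (Fin s → Fin d → Torus))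
    (hT : ∀ x (j : Fin s), T x j = stdWeyl d (β j : Torus) (x j))
    (hKron : ∀ (m : ℕ) (q : Fin m → Polynomial ℝ),
      (∀ i, q i ∈ WP P d ∧ IsIntegralPoly (q i)) →
      ∀ ε : ℝ, 0 < ε → ∃ n ∈ R, ∀ (i : Fin m) (j : Fin s),
        ‖(((q i).eval (n : ℝ) * β j : ℝ) : Torus)‖ < ε) :
    ∀ A : Set (Fin s → Fin d → Torus), MeasurableSet A →
      0 < MeasureTheory.volume A →
      ∃ n ∈ R, 0 < MeasureTheory.volume
        (A ∩ ⋂ k : Fin r, (T ^ (ieval (P k) n)) ⁻¹' A) := by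
  intro A hA hpos
  by_cases hne : ∀ n ∈ R, ∃ k, ieval (P k) n ≠ 0
  · have := recurrenceFilter_neBot hd hs R P hint β hβ hKron hne
    have hev := eventually_measure_iInter_zpow_pos (isIntegralPoly_addZero hint)
      (eval_zero_addZero hz) β T hT _
      (recurrenceFilter_le_cofinite R {q | q ∈ WP P d ∧ IsIntegralPoly q} β)
      (fun v hv j => tendsto_recurrenceFilter R
        {q | q ∈ WP P d ∧ IsIntegralPoly q} β ⟨transPoly_mem_WP hd P hz v j (hv j),
          isIntegralPoly_transPoly (isIntegralPoly_addZero hint) v j⟩ j) A hA hpos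
    obtain ⟨n, hn, hnR⟩ := (hev.and (mem_recurrenceFilter R _ β)).exists
    refine ⟨n, hnR, ?_⟩
    simpa [Set.iInter_option, addZero, ieval] using hn
  · push Not at hne
    obtain ⟨n, hn, h0⟩ := hne
    refine ⟨n, hn, hpos.trans_le (measure_mono fun x hx => ⟨hx, ?_⟩)⟩
    simpa [h0] using fun _ => hx

end
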